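/- Performance Difference Lemma: For any two policies π and π* in a discounted MDP, the difference in expected discounted returns equals the expected discounted sum of advantages of π evaluated along trajectories generated by π*: η(π*) − η(π) = E_{τ∼π*}[ Σ_{t=0}^∞ γ^t A^π(s_t, a_t) ]. -/

import Mathlib

open scoped BigOperators

/-- A finite, infinite-horizon discounted MDP `(S, A, P, r, ρ0, γ)`. -/
structure MDP (S A : Type) [Fintype S] [Fintype A] where
  P : S → A → S → ℝ
  r : S → ℝ
  ρ0 : S → ℝ
  γ : ℝ
  P_nonneg : ∀ s a s', 0 ≤ P s a s'
  P_sum : ∀ s a, ∑ s', P s a s' = 1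
  ρ0_nonneg : ∀ s, 0 ≤ ρ0 s
  ρ0_sum : ∑ s, ρ0 s = 1
  γ_pos : 0 < γ
  γ_lt_one : γ < 1

variable {S A : Type} [Fintype S] [Fintype A] [DecidableEq S] [DecidableEq A]

/-- A stochastic policy: a probability distribution over actions at each state. -/
def IsPolicy (π : S → A → ℝ) : Prop :=
  (∀ s a, 0 ≤ π s a) ∧ ∀ s, ∑ a, π s a = 1

namespace MDP

/-- Distribution of the state `s_t` when `s_0 ∼ d` and actions are sampled from `π`. -/
def stateDist (M : MDP S A) (π : S → A → ℝ) : ℕ → (S → ℝ) → S → ℝ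
  | 0, d => d
  | t + 1, d => fun s' => ∑ s, ∑ a, M.stateDist π t d s * π s a * M.P s a s'

/-- Dirac distribution concentrated at a state. -/
def dirac (s : S) : S → ℝ := fun x => if x = s then 1 else 0

/-- Value function `V^π(s) = E[∑_t γ^t r(s_t) | s_0 = s]`. -/
noncomputable def V (M : MDP S A) (π : S → A → ℝ) (s : S) : ℝ :=
  ∑' t : ℕ, M.γ ^ t * ∑ s', M.stateDist π t (dirac s) s' * M.r s'

/-- State-action value `Q^π(s,a) = r(s) + γ E_{s'∼P(·|s,a)}[V^π(s')]`. -/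
noncomputable def Q (M : MDP S A) (π : S → A → ℝ) (s : S) (a : A) : ℝ :=
  M.r s + M.γ * ∑ s', M.P s a s' * M.V π s'

/-- Advantage function `A^π(s,a) = Q^π(s,a) − V^π(s)`. -/
noncomputable def Adv (M : MDP S A) (π : S → A → ℝ) (s : S) (a : A) : ℝ :=
  M.Q π s a - M.V π s

/-- Expected discounted return `η(π) = E_{s0∼ρ0}[V^π(s0)]`. -/
noncomputable def η (M : MDP S A) (π : S → A → ℝ) : ℝ :=
  ∑ s, M.ρ0 s * M.V π s

/-- `E_{τ∼π*}[∑_t γ^t A^π(s_t, a_t)]`: expected discounted advantage sum of `π`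
along trajectories generated by `π*` from `ρ0`. -/
noncomputable def advSum (M : MDP S A) (π πStar : S → A → ℝ) : ℝ :=
  ∑' t : ℕ, M.γ ^ t * ∑ s, ∑ a, M.stateDist πStar t M.ρ0 s * πStar s a * M.Adv π s a

end MDP

theorem MDP.stateDist_prob (M : MDP S A) (π : S → A → ℝ) (hπ : IsPolicy π) (d : S → ℝ)
    (h0 : ∀ s, 0 ≤ d s) (h1 : ∑ s, d s = 1) (t : ℕ) :
    (∀ s, 0 ≤ M.stateDist π t d s) ∧ ∑ s, M.stateDist π t d s = 1 := by
  induction t with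
  | zero => exact ⟨h0, h1⟩
  | succ t ih =>
    refine ⟨fun s => ?_, ?_⟩
    · simp only [MDP.stateDist]
      exact Finset.sum_nonneg fun x _ => Finset.sum_nonneg fun a _ =>
        mul_nonneg (mul_nonneg (ih.1 x) (hπ.1 x a)) (M.P_nonneg x a s)
    · simp only [MDP.stateDist]
      rw [Finset.sum_comm]
      rw [← ih.2]
      refine Finset.sum_congr rfl fun x _ => ?_
      rw [Finset.sum_comm]
      simp only [← Finset.mul_sum, M.P_sum, mul_one, hπ.2]

theorem MDP.summable_stateDist (M : MDP S A) (π : S → A → ℝ) (hπ : IsPolicy π) (d : S → ℝ)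
    (h0 : ∀ s, 0 ≤ d s) (h1 : ∑ s, d s = 1) (g : S → ℝ) :
    Summable fun t : ℕ => M.γ ^ t * ∑ s, M.stateDist π t d s * g s := by
  refine Summable.of_norm_bounded (g := fun t : ℕ => M.γ ^ t * ∑ s, |g s|)
    ((summable_geometric_of_lt_one M.γ_pos.le M.γ_lt_one).mul_right _) fun t => ?_
  obtain ⟨p0, p1⟩ := M.stateDist_prob π hπ d h0 h1 t
  rw [Real.norm_eq_abs, abs_mul, abs_of_nonneg (pow_nonneg M.γ_pos.le t)]
  refine mul_le_mul_of_nonneg_left ?_ (pow_nonneg M.γ_pos.le t)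
  refine (Finset.abs_sum_le_sum_abs _ _).trans (Finset.sum_le_sum fun s _ => ?_)
  rw [abs_mul, abs_of_nonneg (p0 s)]
  refine mul_le_of_le_one_left (abs_nonneg _) ?_
  rw [← p1]
  exact Finset.single_le_sum (fun i _ => p0 i) (Finset.mem_univ s)

theorem MDP.stateDist_linear (M : MDP S A) (π : S → A → ℝ) (d : S → ℝ) (t : ℕ) (s' : S) :
    M.stateDist π t d s' = ∑ s, d s * M.stateDist π t (MDP.dirac s) s' := by
  induction t generalizing s' with
  | zero => simp [MDP.stateDist, MDP.dirac]
  | succ t ih =>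
    simp only [MDP.stateDist]
    simp only [ih, Finset.mul_sum, Finset.sum_mul]
    rw [Finset.sum_comm' (t' := Finset.univ) (s' := fun _ => Finset.univ) (by simp)]
    conv_rhs => rw [Finset.sum_comm]
    rw [Finset.sum_comm]
    refine Finset.sum_congr rfl fun x _ => ?_
    conv_rhs => rw [Finset.sum_comm]
    refine Finset.sum_congr rfl fun a _ => Finset.sum_congr rfl fun y _ => ?_
    ring

theorem MDP.eta_eq (M : MDP S A) (π : S → A → ℝ) (hπ : IsPolicy π) :
    M.η π = ∑' t : ℕ, M.γ ^ t * ∑ s, M.stateDist π t M.ρ0 s * M.r s := by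
  have hs : ∀ s : S, Summable fun t : ℕ =>
      M.ρ0 s * (M.γ ^ t * ∑ s', M.stateDist π t (MDP.dirac s) s' * M.r s') := fun s =>
    (M.summable_stateDist π hπ _ (fun x => by unfold MDP.dirac; split_ifs <;> norm_num)
      (by simp [MDP.dirac]) M.r).mul_left _
  simp only [MDP.η, MDP.V, ← tsum_mul_left]
  rw [← Summable.tsum_finsetSum fun s _ => hs s]
  refine tsum_congr fun t => ?_
  simp only [M.stateDist_linear π M.ρ0 t, Finset.mul_sum, Finset.sum_mul]
  rw [Finset.sum_comm]
  refine Finset.sum_congr rfl fun x _ => Finset.sum_congr rfl fun y _ => ?_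
  ring

theorem MDP.adv_step (M : MDP S A) (π πStar : S → A → ℝ) (h : IsPolicy πStar) (t : ℕ) :
    ∑ s, ∑ a, M.stateDist πStar t M.ρ0 s * πStar s a * M.Adv π s a
      = ∑ s, M.stateDist πStar t M.ρ0 s * M.r s
        + M.γ * ∑ s, M.stateDist πStar (t + 1) M.ρ0 s * M.V π s
        - ∑ s, M.stateDist πStar t M.ρ0 s * M.V π s := by
  have e1 : ∀ g : S → ℝ, ∑ s, ∑ a, M.stateDist πStar t M.ρ0 s * πStar s a * g s
      = ∑ s, M.stateDist πStar t M.ρ0 s * g s := fun g => by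
    refine Finset.sum_congr rfl fun s _ => ?_
    rw [← Finset.sum_mul, ← Finset.mul_sum, h.2, mul_one]
  have e2 : ∑ s, M.stateDist πStar (t + 1) M.ρ0 s * M.V π s
      = ∑ s, ∑ a, M.stateDist πStar t M.ρ0 s * πStar s a * ∑ s', M.P s a s' * M.V π s' := by
    simp only [MDP.stateDist, Finset.mul_sum, Finset.sum_mul]
    rw [Finset.sum_comm]
    refine Finset.sum_congr rfl fun x _ => ?_
    rw [Finset.sum_comm]
    refine Finset.sum_congr rfl fun a _ => Finset.sum_congr rfl fun y _ => ?_
    ring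
  rw [e2, ← e1, ← e1, Finset.mul_sum, ← Finset.sum_add_distrib, ← Finset.sum_sub_distrib]
  refine Finset.sum_congr rfl fun x _ => ?_
  rw [Finset.mul_sum, ← Finset.sum_add_distrib, ← Finset.sum_sub_distrib]
  refine Finset.sum_congr rfl fun a _ => ?_
  simp only [MDP.Adv, MDP.Q]
  ring

/-- Performance Difference Lemma. -/
theorem performance_difference (M : MDP S A) (π πStar : S → A → ℝ)
    (hπ : IsPolicy π) (hπStar : IsPolicy πStar) :
    M.η πStar - M.η π = M.advSum π πStar := by
  have hr := M.summable_stateDist πStar hπStar M.ρ0 M.ρ0_nonneg M.ρ0_sum M.r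
  have hv := M.summable_stateDist πStar hπStar M.ρ0 M.ρ0_nonneg M.ρ0_sum (M.V π)
  have hv1 := (summable_nat_add_iff 1).2 hv
  have hz := hv.tsum_eq_zero_add
  have key : M.advSum π πStar
      = ∑' t : ℕ, (M.γ ^ t * ∑ s, M.stateDist πStar t M.ρ0 s * M.r s
        + M.γ ^ (t + 1) * ∑ s, M.stateDist πStar (t + 1) M.ρ0 s * M.V π s
        - M.γ ^ t * ∑ s, M.stateDist πStar t M.ρ0 s * M.V π s) := by
    refine tsum_congr fun t => ?_
    rw [M.adv_step π πStar hπStar t]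
    ring
  rw [key, (hr.add hv1).tsum_sub hv, hr.tsum_add hv1, ← M.eta_eq πStar hπStar, hz]
  simp only [MDP.η, MDP.stateDist, pow_zero, one_mul]
  ring
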